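/- arXiv:1209.1083 — 8 statements merged into one kernel-verified Lean document; each statement's English description precedes it below -/
import Mathlib

section
/- Let M be a module over the polynomial ring K[X] over a field K of characteristic zero, separated and complete in the X-adic topology, and let p : M → M be a K-linear map with p(X•m) = X•p(m) + m for all m (the Weyl-algebra relation [p,q] = 1, where q is the action of X). Then for every m ∈ M there exists a unique sequence (c_i)_{i∈ℕ} of elements of ker(p) such that for every N ∈ ℕ one has m − ∑_{i<N} X^i • c_i ∈ X^N M; that is, every element of M is in a unique way an X-adically convergent series ∑_{i≥0} X^i • c_i with all coefficients c_i in ker(p) (so M ≅ K[[X]] ⊗̂ ker(p)). -/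
open Polynomial in
theorem mem_span_X_pow_smul_top_iff {R M : Type*} [CommRing R] [AddCommGroup M] [Module R[X] M]
    {n : ℕ} {x : M} :
    x ∈ (Ideal.span {(X : R[X])}) ^ n • (⊤ : Submodule R[X] M) ↔
      ∃ y : M, (X : R[X]) ^ n • y = x := by
  rw [Ideal.span_singleton_pow, Submodule.ideal_span_singleton_smul,
    Submodule.mem_smul_pointwise_iff_exists]
  simp

namespace WeylModule

open Polynomial

variable {K : Type*} [Field K] {M : Type*} [AddCommGroup M] [Module K[X] M] [Module K M]
  {p : M →ₗ[K] M}

theorem map_X_pow_succ_smul (hp : ∀ m : M, p ((X : K[X]) • m) = (X : K[X]) • p m + m)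
    (n : ℕ) (m : M) :
    p ((X : K[X]) ^ (n + 1) • m) = (X : K[X]) ^ (n + 1) • p m + (n + 1) • (X : K[X]) ^ n • m := by
  induction n with
  | zero => simp [hp]
  | succ n ih =>
    rw [pow_succ' _ (n + 1), mul_smul, hp, ih, smul_add, smul_comm (X : K[X]) (n + 1),
      ← mul_smul, ← mul_smul, ← pow_succ', ← pow_succ', add_assoc, ← succ_nsmul]

/-- The image under `p` of the truncated series `∑ (-X)ᵏ/k! • pᵏ m` telescopes to one term. -/
theorem map_taylor_sum [CharZero K]
    (hp : ∀ m : M, p ((X : K[X]) • m) = (X : K[X]) • p m + m) (m : M) (n : ℕ) :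
    p (∑ k ∈ Finset.range (n + 1),
        ((-1) ^ k * (k.factorial : K)⁻¹) • (X : K[X]) ^ k • (p ^ k) m) =
      ((-1) ^ n * (n.factorial : K)⁻¹) • (X : K[X]) ^ n • (p ^ (n + 1)) m := by
  induction n with
  | zero => simp
  | succ n ih =>
    have coeff : ((-1) ^ (n + 1) * ((n + 1).factorial : K)⁻¹) * ((n + 1 : ℕ) : K) =
        -((-1) ^ n * (n.factorial : K)⁻¹) := by
      have h₁ : ((n + 1 : ℕ) : K) ≠ 0 := Nat.cast_ne_zero.mpr n.succ_ne_zero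
      have h₂ : (n.factorial : K) ≠ 0 := Nat.cast_ne_zero.mpr n.factorial_ne_zero
      rw [Nat.factorial_succ, Nat.cast_mul]
      field_simp
      ring
    rw [Finset.sum_range_succ, map_add, ih, map_smul, map_X_pow_succ_smul hp, smul_add,
      ← Nat.cast_smul_eq_nsmul K (n + 1), smul_smul, coeff, neg_smul, pow_succ' p (n + 1),
      Module.End.mul_apply]
    abel

variable [IsScalarTower K K[X] M]

/-- `M = ker p + X M`. -/
theorem exists_ker_add_X_smul [CharZero K] [IsAdicComplete (Ideal.span {(X : K[X])}) M]
    (hp : ∀ m : M, p ((X : K[X]) • m) = (X : K[X]) • p m + m) (m : M) :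
    ∃ c r : M, p c = 0 ∧ m = c + (X : K[X]) • r := by
  have comm : SMulCommClass K K[X] M := IsScalarTower.to_smulCommClass
  set f : ℕ → M := fun n ↦ ∑ k ∈ Finset.range n,
    ((-1) ^ k * (k.factorial : K)⁻¹) • (X : K[X]) ^ k • (p ^ k) m with hf
  obtain ⟨L, hL⟩ := IsPrecomplete.prec (I := Ideal.span {(X : K[X])}) (M := M) inferInstance
    (f := f) (by
      intro a b hab
      rw [SModEq.comm, SModEq.sub_mem, hf]
      simp only
      rw [← Finset.sum_range_add_sum_Ico _ hab, add_sub_cancel_left]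
      refine Submodule.sum_mem _ fun k hk ↦ mem_span_X_pow_smul_top_iff.mpr
        ⟨((-1) ^ k * (k.factorial : K)⁻¹) • (X : K[X]) ^ (k - a) • (p ^ k) m, ?_⟩
      rw [← smul_comm, smul_smul, ← pow_add, Nat.add_sub_cancel' (Finset.mem_Ico.mp hk).1])
  have hL' (n : ℕ) : ∃ y : M, (X : K[X]) ^ n • y = f n - L :=
    mem_span_X_pow_smul_top_iff.mp (SModEq.sub_mem.mp (hL n))
  obtain ⟨r, hr⟩ := hL' 1
  refine ⟨L, r, ?_, ?_⟩
  · refine IsHausdorff.haus (I := Ideal.span {(X : K[X])}) inferInstance _ fun n ↦ ?_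
    rw [SModEq.zero, mem_span_X_pow_smul_top_iff]
    obtain ⟨y, hy⟩ := hL' (n + 1)
    refine ⟨((-1) ^ n * (n.factorial : K)⁻¹) • (p ^ (n + 1)) m -
      ((X : K[X]) • p y + (n + 1) • y), ?_⟩
    have hpL := congrArg p (eq_sub_iff_add_eq'.mp hy)
    rw [map_add, map_X_pow_succ_smul hp, map_taylor_sum hp, ← eq_sub_iff_add_eq] at hpL
    rw [hpL, smul_sub, smul_add, ← smul_comm, smul_comm _ (n + 1), ← mul_smul _ X,
      ← pow_succ X]
  · simp only [hf, pow_one, Finset.sum_range_one, pow_zero, Nat.factorial_zero,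
      Nat.cast_one, inv_one, mul_one, one_smul, Module.End.one_apply] at hr
    rw [hr]
    abel

/-- `ker p ∩ X M = 0`. -/
theorem eq_zero_of_map_eq_zero [CharZero K] [IsHausdorff (Ideal.span {(X : K[X])}) M]
    (hp : ∀ m : M, p ((X : K[X]) • m) = (X : K[X]) • p m + m) {c r : M}
    (hc : p c = 0) (hr : (X : K[X]) • r = c) : c = 0 := by
  have comm : SMulCommClass K K[X] M := IsScalarTower.to_smulCommClass
  have divisible (n : ℕ) : ∃ y : M, (X : K[X]) ^ (n + 1) • y = c := by
    induction n with
    | zero => exact ⟨r, by simpa using hr⟩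
    | succ n ih =>
      obtain ⟨y, rfl⟩ := ih
      rw [map_X_pow_succ_smul hp, ← Nat.cast_smul_eq_nsmul K] at hc
      have h : ((n + 1 : ℕ) : K) ≠ 0 := Nat.cast_ne_zero.mpr n.succ_ne_zero
      refine ⟨-((n + 1 : ℕ) : K)⁻¹ • p y, ?_⟩
      have hy : (X : K[X]) ^ n • y =
          -((n + 1 : ℕ) : K)⁻¹ • (X : K[X]) ^ (n + 1) • p y := by
        rw [eq_neg_of_add_eq_zero_left hc, neg_smul, smul_neg, neg_neg, inv_smul_smul₀ h]
      rw [pow_succ' _ n, mul_smul _ _ y, hy, smul_comm (X : K[X]), ← smul_comm, ← mul_smul,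
        ← pow_succ']
  refine IsHausdorff.haus (I := Ideal.span {(X : K[X])}) inferInstance _ fun n ↦ ?_
  rw [SModEq.zero, mem_span_X_pow_smul_top_iff]
  obtain ⟨y, hy⟩ := divisible n
  exact ⟨(X : K[X]) • y, by rw [← mul_smul, ← pow_succ, hy]⟩

theorem eq_zero_of_X_pow_smul_eq [CharZero K] [IsHausdorff (Ideal.span {(X : K[X])}) M]
    (hp : ∀ m : M, p ((X : K[X]) • m) = (X : K[X]) • p m + m) {c : M} (hc : p c = 0)
    (n : ℕ) {r : M} (hr : (X : K[X]) ^ (n + 1) • r = (X : K[X]) ^ n • c) : c = 0 := by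
  have comm : SMulCommClass K K[X] M := IsScalarTower.to_smulCommClass
  induction n generalizing r with
  | zero => exact eq_zero_of_map_eq_zero hp hc (by simpa using hr)
  | succ n ih =>
    have h : ((n + 1 : ℕ) : K) ≠ 0 := Nat.cast_ne_zero.mpr n.succ_ne_zero
    have hpr := congrArg p hr
    rw [map_X_pow_succ_smul hp, map_X_pow_succ_smul hp, hc, smul_zero, zero_add,
      ← Nat.cast_smul_eq_nsmul K (n + 1)] at hpr
    refine ih (r := ((n + 1 : ℕ) : K)⁻¹ • ((X : K[X]) • p r + (n + 1 + 1) • r)) ?_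
    rw [← smul_comm, smul_add, ← mul_smul, ← pow_succ, smul_comm _ (n + 1 + 1), hpr,
      inv_smul_smul₀ h]

theorem coeff_unique [CharZero K] [IsHausdorff (Ideal.span {(X : K[X])}) M]
    (hp : ∀ m : M, p ((X : K[X]) • m) = (X : K[X]) • p m + m) {m : M} {c d : ℕ → M}
    (hc : ∀ i, p (c i) = 0) (hd : ∀ i, p (d i) = 0)
    (hcm : ∀ N : ℕ, m - ∑ i ∈ Finset.range N, (X : K[X]) ^ i • c i ∈
      (Ideal.span {(X : K[X])}) ^ N • (⊤ : Submodule K[X] M))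
    (hdm : ∀ N : ℕ, m - ∑ i ∈ Finset.range N, (X : K[X]) ^ i • d i ∈
      (Ideal.span {(X : K[X])}) ^ N • (⊤ : Submodule K[X] M)) : d = c := by
  funext n
  induction n using Nat.strong_induction_on with
  | _ n ih =>
    obtain ⟨y, hy⟩ := mem_span_X_pow_smul_top_iff.mp
      (Submodule.sub_mem _ (hcm (n + 1)) (hdm (n + 1)))
    have heq : ∑ i ∈ Finset.range n, (X : K[X]) ^ i • d i =
        ∑ i ∈ Finset.range n, (X : K[X]) ^ i • c i :=
      Finset.sum_congr rfl fun i hi ↦ by rw [ih i (Finset.mem_range.mp hi)]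
    refine sub_eq_zero.mp (eq_zero_of_X_pow_smul_eq hp (c := d n - c n)
      (by rw [map_sub, hd, hc, sub_zero]) n (r := y) ?_)
    rw [hy, Finset.sum_range_succ, Finset.sum_range_succ, heq, smul_sub]
    abel

/-- The coefficients are found by repeatedly splitting `m = c + X • r` with `c ∈ ker p`. -/
theorem exists_coeff [CharZero K] [IsAdicComplete (Ideal.span {(X : K[X])}) M]
    (hp : ∀ m : M, p ((X : K[X]) • m) = (X : K[X]) • p m + m) (m : M) :
    ∃ c : ℕ → M, (∀ i, p (c i) = 0) ∧
      ∀ N : ℕ, m - ∑ i ∈ Finset.range N, (X : K[X]) ^ i • c i ∈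
        (Ideal.span {(X : K[X])}) ^ N • (⊤ : Submodule K[X] M) := by
  choose c r hc hr using exists_ker_add_X_smul (M := M) hp
  refine ⟨fun i ↦ c (r^[i] m), fun i ↦ hc _, fun N ↦
    mem_span_X_pow_smul_top_iff.mpr ⟨r^[N] m, ?_⟩⟩
  induction N with
  | zero => simp
  | succ N ih =>
    rw [Finset.sum_range_succ, ← sub_sub, ← ih, Function.iterate_succ_apply', pow_succ,
      mul_smul, ← smul_sub, eq_sub_of_add_eq' (hr _).symm]

end WeylModule

/-- Let `M` be a module over `K[X]` (`K` a field of characteristic zero),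
separated and complete in the `X`-adic topology, and `p : M → M` a `K`-linear map with
`p(X•m) = X•p(m) + m`. Then every `m ∈ M` is in a unique way an `X`-adically convergent
series `∑ X^i • c_i` with all `c_i ∈ ker p`. -/
theorem weyl_module_decomposition
    {K : Type*} [Field K] [CharZero K]
    {M : Type*} [AddCommGroup M] [Module (Polynomial K) M]
    [Module K M] [IsScalarTower K (Polynomial K) M]
    [IsAdicComplete (Ideal.span {(Polynomial.X : Polynomial K)}) M]
    (p : M →ₗ[K] M)
    (hp : ∀ m : M, p ((Polynomial.X : Polynomial K) • m)
        = (Polynomial.X : Polynomial K) • p m + m)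
    (m : M) :
    ∃! c : ℕ → M, (∀ i : ℕ, p (c i) = 0) ∧
      ∀ N : ℕ, m - ∑ i ∈ Finset.range N, (Polynomial.X : Polynomial K) ^ i • c i ∈
        (Ideal.span {(Polynomial.X : Polynomial K)}) ^ N • (⊤ : Submodule (Polynomial K) M) := by
  obtain ⟨c, hc, hcm⟩ := WeylModule.exists_coeff hp m
  exact ⟨c, ⟨hc, hcm⟩, fun d hd ↦ WeylModule.coeff_unique hp hc hd.1 hcm hd.2⟩
end

section
/- Let λ and μ be partitions of the same integer n such that λ is dominated by μ, λ ≠ μ, and the nonzero parts of λ are pairwise distinct. Then ∑_i μ_i² ≥ ∑_i λ_i² + 4. -/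
/-- A partition of `n`: a non-increasing finitely supported sequence of natural numbers
(indexed from `0`) summing to `n`. -/
structure PartitionOf (n : ℕ) where
  parts : ℕ → ℕ
  antitone : ∀ i j : ℕ, i ≤ j → parts j ≤ parts i
  finite_support : (Function.support parts).Finite
  sum_eq : ∑ᶠ i, parts i = n

/-- The multiplicity of the value `v` among the parts of the sequence `f`. -/
noncomputable def partMult (f : ℕ → ℕ) (v : ℕ) : ℕ := {i : ℕ | f i = v}.ncard

/-- The transpose (conjugate) sequence: `(f^t)_i = #{j : f_j ≥ i+1}` (0-based indexing,
so this is `#{j : f_j ≥ i}` in 1-based indexing). -/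
noncomputable def transposeFn (f : ℕ → ℕ) : ℕ → ℕ := fun i => {j : ℕ | i + 1 ≤ f j}.ncard

/-- Dominance order: `f ⊴ g`. -/
def Dominated (f g : ℕ → ℕ) : Prop :=
  ∀ k : ℕ, ∑ i ∈ Finset.range k, f i ≤ ∑ i ∈ Finset.range k, g i

/-- Summation by parts for a difference of sums of squares, in terms of the partial sums of
`b - a`. -/
theorem sum_range_sq_sub_sq_eq (a b : ℕ → ℤ) (N : ℕ) :
    ∑ i ∈ Finset.range N, (b i ^ 2 - a i ^ 2) =
      ∑ i ∈ Finset.range N, (b i - a i) ^ 2 +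
        2 * (∑ i ∈ Finset.range N,
            (∑ k ∈ Finset.range (i + 1), (b k - a k)) * (a i - a (i + 1)) +
          (∑ k ∈ Finset.range N, (b k - a k)) * a N) := by
  induction N with
  | zero => simp
  | succ N ih =>
    rw [Finset.sum_range_succ, ih, Finset.sum_range_succ (fun i => (b i - a i) ^ 2),
      Finset.sum_range_succ (fun i => (∑ k ∈ Finset.range (i + 1), (b k - a k)) * _),
      Finset.sum_range_succ (fun k => b k - a k)]
    ring

/-- Integers summing to zero, one of which is negative, have sum of squares at least two. -/
theorem two_le_sum_sq_of_sum_eq_zero {ι : Type*} {s : Finset ι} {d : ι → ℤ}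
    (hsum : ∑ i ∈ s, d i = 0) {j : ι} (hj : j ∈ s) (hneg : d j < 0) :
    2 ≤ ∑ i ∈ s, d i ^ 2 := by
  have hle : d j ^ 2 - d j ≤ ∑ i ∈ s, (d i ^ 2 - d i) :=
    Finset.single_le_sum (f := fun i => d i ^ 2 - d i)
      (fun i _ => sub_nonneg.2 (Int.le_self_sq (d i))) hj
  rw [Finset.sum_sub_distrib, hsum] at hle
  nlinarith

/-- An antitone integer sequence `a` and a sequence `b` dominating it with the same total satisfy
`∑ a² + 4 ≤ ∑ b²` as soon as `b` drops below `a` at an index where `a` strictly descends. -/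
theorem sum_range_sq_add_four_le {a b : ℕ → ℤ} {N j : ℕ} (ha : Antitone a)
    (hdom : ∀ k, 0 ≤ ∑ i ∈ Finset.range k, (b i - a i))
    (htot : ∑ i ∈ Finset.range N, (b i - a i) = 0)
    (hj : j + 1 < N) (hneg : b (j + 1) < a (j + 1)) (hgap : a (j + 1) < a j) :
    ∑ i ∈ Finset.range N, a i ^ 2 + 4 ≤ ∑ i ∈ Finset.range N, b i ^ 2 := by
  have hsq : 2 ≤ ∑ i ∈ Finset.range N, (b i - a i) ^ 2 :=
    two_le_sum_sq_of_sum_eq_zero htot (Finset.mem_range.2 hj) (sub_neg.2 hneg)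
  have hpos : 0 < ∑ k ∈ Finset.range (j + 1), (b k - a k) := by
    have h := hdom (j + 1 + 1)
    rw [Finset.sum_range_succ] at h
    linarith
  have hterm : (∑ k ∈ Finset.range (j + 1), (b k - a k)) * (a j - a (j + 1)) ≤
      ∑ i ∈ Finset.range N, (∑ k ∈ Finset.range (i + 1), (b k - a k)) * (a i - a (i + 1)) :=
    Finset.single_le_sum
      (f := fun i => (∑ k ∈ Finset.range (i + 1), (b k - a k)) * (a i - a (i + 1)))
      (fun i _ => mul_nonneg (hdom _) (sub_nonneg.2 (ha i.le_succ)))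
      (Finset.mem_range.2 (by omega))
  have hone := mul_pos hpos (sub_pos.2 hgap)
  have habel := sum_range_sq_sub_sq_eq a b N
  rw [htot, Finset.sum_sub_distrib] at habel
  linarith

/-- The `finsum` of a sequence vanishing from `N` on is its sum over `range N`. -/
theorem finsum_eq_sum_range {M : Type*} [AddCommMonoid M] {f : ℕ → M} {N : ℕ}
    (hf : ∀ i, N ≤ i → f i = 0) : ∑ᶠ i, f i = ∑ i ∈ Finset.range N, f i := by
  refine finsum_eq_sum_of_support_subset f fun i hi => ?_
  by_contra h
  exact hi (hf i (by simpa using h))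

/-- The parts of a partition eventually vanish. -/
theorem PartitionOf.exists_forall_ge_parts_eq_zero {n : ℕ} (p : PartitionOf n) :
    ∃ N, ∀ i, N ≤ i → p.parts i = 0 := by
  obtain ⟨B, hB⟩ := p.finite_support.bddAbove
  refine ⟨B + 1, fun i hi => ?_⟩
  by_contra h
  have := hB h
  omega

/-- if `λ ⊴ μ` are distinct partitions of the same `n` and the nonzero parts
of `λ` are pairwise distinct, then `∑ μ_i² ≥ ∑ λ_i² + 4`. -/
theorem sum_sq_dominance_ge_add_four
    {n : ℕ} (lam mu : PartitionOf n)
    (hdom : Dominated lam.parts mu.parts)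
    (hne : lam.parts ≠ mu.parts)
    (hdist : ∀ i j : ℕ, lam.parts i ≠ 0 → lam.parts i = lam.parts j → i = j) :
    (∑ᶠ i, (lam.parts i) ^ 2) + 4 ≤ ∑ᶠ i, (mu.parts i) ^ 2 := by
  obtain ⟨N₁, h₁⟩ := lam.exists_forall_ge_parts_eq_zero
  obtain ⟨N₂, h₂⟩ := mu.exists_forall_ge_parts_eq_zero
  obtain ⟨N, hN₁, hN₂⟩ : ∃ N, N₁ ≤ N ∧ N₂ ≤ N := ⟨max N₁ N₂, le_max_left _ _, le_max_right _ _⟩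
  have hlam : ∀ i, N ≤ i → lam.parts i = 0 := fun i hi => h₁ i (hN₁.trans hi)
  have hmu : ∀ i, N ≤ i → mu.parts i = 0 := fun i hi => h₂ i (hN₂.trans hi)
  have htot : ∑ i ∈ Finset.range N, lam.parts i = ∑ i ∈ Finset.range N, mu.parts i := by
    rw [← finsum_eq_sum_range hlam, ← finsum_eq_sum_range hmu, lam.sum_eq, mu.sum_eq]
  obtain ⟨m, hm⟩ : ∃ m, mu.parts m < lam.parts m := by
    by_contra! hle
    have heq := (Finset.sum_eq_sum_iff_of_le fun i _ => hle i).1 htot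
    refine hne (funext fun i => ?_)
    rcases lt_or_ge i N with hi | hi
    · exact heq i (Finset.mem_range.2 hi)
    · rw [hlam i hi, hmu i hi]
  have hmN : m < N := by
    by_contra! h
    have := hlam m h
    omega
  obtain _ | j := m
  · have := hdom 1
    simp only [Finset.sum_range_one] at this
    omega
  have hgap : lam.parts (j + 1) < lam.parts j := by
    refine lt_of_le_of_ne (lam.antitone _ _ j.le_succ) fun h => ?_
    have := hdist _ _ (by omega) h
    omega
  rw [finsum_eq_sum_range fun i hi => by rw [hlam i hi, zero_pow two_ne_zero],
    finsum_eq_sum_range fun i hi => by rw [hmu i hi, zero_pow two_ne_zero]]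
  have key := sum_range_sq_add_four_le (a := fun i => (lam.parts i : ℤ))
    (b := fun i => (mu.parts i : ℤ)) (N := N) (j := j)
    (fun i k hik => Int.ofNat_le.2 (lam.antitone i k hik))
    (fun k => by
      rw [Finset.sum_sub_distrib, sub_nonneg]
      exact_mod_cast hdom k)
    (by
      rw [Finset.sum_sub_distrib, sub_eq_zero]
      exact_mod_cast htot.symm)
    hmN (by exact_mod_cast hm) (by exact_mod_cast hgap)
  exact_mod_cast key
end

section
/- Let n ≥ 1, let 1 ≤ m ≤ n, let λ be a partition of 2n+1 and μ a partition of 2(n−m)+1 (padded with zeros) such that λ_i = μ_i + 2 for 1 ≤ i ≤ m and λ_i = μ_i for i > m. Assume that λ, λ^t and μ are all of type B. Then μ^t is also of type B. -/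
/-- A sequence is of type B if every even part occurs with even multiplicity. -/
def IsTypeB (f : ℕ → ℕ) : Prop := ∀ v : ℕ, 0 < v → Even v → Even (partMult f v)

theorem lt_transposeFn_iff {f : ℕ → ℕ} (hf : Antitone f) (hfin : (Function.support f).Finite)
    (i k : ℕ) : k < transposeFn f i ↔ i < f k := by
  have hset : {j : ℕ | i + 1 ≤ f j}.Finite :=
    hfin.subset fun j (hj : i + 1 ≤ f j) => Function.mem_support.2 (by omega)
  constructor
  · contrapose!
    intro h
    have hsub : {j : ℕ | i + 1 ≤ f j} ⊆ Set.Iio k := by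
      intro j (hj : i + 1 ≤ f j)
      by_contra hjk
      have := hf (not_lt.1 hjk)
      omega
    simpa [transposeFn] using Set.ncard_le_ncard hsub (Set.finite_Iio k)
  · intro h
    have hsub : Set.Iio (k + 1) ⊆ {j : ℕ | i + 1 ≤ f j} := fun j hj =>
      (Nat.succ_le_of_lt h).trans (hf (Nat.lt_succ_iff.1 hj))
    simpa [transposeFn] using Set.ncard_le_ncard hsub hset

theorem partMult_transposeFn_succ {f : ℕ → ℕ} (hf : Antitone f)
    (hfin : (Function.support f).Finite) (v : ℕ) :
    partMult (transposeFn f) (v + 1) = f v - f (v + 1) := by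
  have hset : {i : ℕ | transposeFn f i = v + 1} = Set.Ico (f (v + 1)) (f v) := by
    ext i
    have h₁ := lt_transposeFn_iff hf hfin i v
    have h₂ := lt_transposeFn_iff hf hfin i (v + 1)
    simp only [Set.mem_ofPred_eq, Set.mem_Ico]
    omega
  simp [partMult, hset]

/-- The type B condition on the transpose only depends on the parities of the parts. -/
theorem isTypeB_transposeFn_iff {f : ℕ → ℕ} (hf : Antitone f)
    (hfin : (Function.support f).Finite) :
    IsTypeB (transposeFn f) ↔ ∀ v : ℕ, Even (v + 1) → (Even (f v) ↔ Even (f (v + 1))) := by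
  have key (v : ℕ) :
      Even (partMult (transposeFn f) (v + 1)) ↔ (Even (f v) ↔ Even (f (v + 1))) := by
    rw [partMult_transposeFn_succ hf hfin, Nat.even_sub (hf v.le_succ)]
  constructor
  · exact fun h v hv => (key v).1 (h (v + 1) v.succ_pos hv)
  · rintro h (_ | v) hpos hv
    · exact absurd hpos (lt_irrefl 0)
    · exact (key v).2 (h v hv)

/-- if a special type-B partition `λ` of `2n+1` is obtained from a type-B
partition `μ` of `2(n−m)+1` by adding `2` to each of the first `m` parts (case (a) of
Lusztig–Spaltenstein induction), then `μ^t` is also of type B, i.e. `μ` is special. -/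
theorem induced_from_special_typeB
    {n m : ℕ} (hn : 1 ≤ n) (hm1 : 1 ≤ m) (hmn : m ≤ n)
    (lam : PartitionOf (2 * n + 1)) (mu : PartitionOf (2 * (n - m) + 1))
    (hrel1 : ∀ i : ℕ, i < m → lam.parts i = mu.parts i + 2)
    (hrel2 : ∀ i : ℕ, m ≤ i → lam.parts i = mu.parts i)
    (hlamB : IsTypeB lam.parts)
    (hlamtB : IsTypeB (transposeFn lam.parts))
    (hmuB : IsTypeB mu.parts) :
    IsTypeB (transposeFn mu.parts) := by
  have hparity (i : ℕ) : Even (lam.parts i) ↔ Even (mu.parts i) := by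
    rcases lt_or_ge i m with hi | hi
    · simp [hrel1 i hi, Nat.even_add]
    · rw [hrel2 i hi]
  rw [isTypeB_transposeFn_iff lam.antitone lam.finite_support] at hlamtB
  rw [isTypeB_transposeFn_iff mu.antitone mu.finite_support]
  simpa only [hparity] using hlamtB
end

section
/- Let n ≥ 1, let 1 ≤ m ≤ n, let λ be a partition of 2n and μ a partition of 2(n−m) (padded with zeros) such that λ_i = μ_i + 2 for 1 ≤ i ≤ m and λ_i = μ_i for i > m. Assume that λ and μ are of type D (every even part occurs with even multiplicity) and that λ^t is of type C. Then μ^t is also of type C. -/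
/-- A sequence is of type C if every odd part occurs with even multiplicity. -/
def IsTypeC (f : ℕ → ℕ) : Prop := ∀ v : ℕ, 0 < v → Odd v → Even (partMult f v)

/-- A sequence is of type D if every even part occurs with even multiplicity. -/
def IsTypeD (f : ℕ → ℕ) : Prop := ∀ v : ℕ, 0 < v → Even v → Even (partMult f v)

/-- The multiplicity of `k + 1` in the transpose is the drop of the sequence at `k`. -/
theorem partMult_transposeFn {f : ℕ → ℕ} (hf : Antitone f)
    (hfin : (Function.support f).Finite) (k : ℕ) :
    partMult (transposeFn f) (k + 1) = f k - f (k + 1) := by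
  have hset : {i : ℕ | transposeFn f i = k + 1} = Set.Ico (f (k + 1)) (f k) := by
    ext i
    have h₁ := lt_transposeFn_iff hf hfin i k
    have h₂ := lt_transposeFn_iff hf hfin i (k + 1)
    simp only [Set.mem_ofPred_eq, Set.mem_Ico]
    omega
  rw [partMult, hset, Set.ncard_Ico_nat]

/-- The transpose is of type C exactly when the parts in positions `k` and `k + 1`, for even `k`
(counting from `0`), have the same parity. -/
theorem isTypeC_transposeFn_iff {f : ℕ → ℕ} (hf : Antitone f)
    (hfin : (Function.support f).Finite) :
    IsTypeC (transposeFn f) ↔ ∀ k : ℕ, Even k → (Even (f k) ↔ Even (f (k + 1))) := by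
  have key (k : ℕ) : Even (partMult (transposeFn f) (k + 1)) ↔ (Even (f k) ↔ Even (f (k + 1))) := by
    rw [partMult_transposeFn hf hfin, Nat.even_sub (hf k.le_succ)]
  constructor
  · intro h k hk
    exact (key k).mp (h (k + 1) k.succ_pos hk.add_one)
  · rintro h (_ | k) hpos hodd
    · exact absurd hpos (lt_irrefl 0)
    · exact (key k).mpr (h k (by simpa [Nat.odd_add_one] using hodd))

/-- if a type-D partition `λ` of `2n` with `λ^t` of type C is obtained from a
type-D partition `μ` of `2(n−m)` by adding `2` to each of the first `m` parts (case (a) of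
Lusztig–Spaltenstein induction), then `μ^t` is also of type C, i.e. `μ` is special. -/
theorem induced_from_special_typeD
    {n m : ℕ} (hn : 1 ≤ n) (hm1 : 1 ≤ m) (hmn : m ≤ n)
    (lam : PartitionOf (2 * n)) (mu : PartitionOf (2 * (n - m)))
    (hrel1 : ∀ i : ℕ, i < m → lam.parts i = mu.parts i + 2)
    (hrel2 : ∀ i : ℕ, m ≤ i → lam.parts i = mu.parts i)
    (hlamD : IsTypeD lam.parts)
    (hmuD : IsTypeD mu.parts)
    (hlamtC : IsTypeC (transposeFn lam.parts)) :
    IsTypeC (transposeFn mu.parts) := by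
  have hparity (i : ℕ) : Even (lam.parts i) ↔ Even (mu.parts i) := by
    rcases lt_or_ge i m with hi | hi
    · rw [hrel1 i hi, Nat.even_add]
      simp
    · rw [hrel2 i hi]
  rw [isTypeC_transposeFn_iff (fun i j => lam.antitone i j) lam.finite_support] at hlamtC
  rw [isTypeC_transposeFn_iff (fun i j => mu.antitone i j) mu.finite_support]
  intro k hk
  rw [← hparity k, ← hparity (k + 1)]
  exact hlamtC k hk
end

section
/- Let n ≥ 0 and let λ be a partition of 2n+1 such that both λ and λ^t are of type B. Assume there exist no m with 1 ≤ m ≤ n and no partition μ of 2(n−m)+1 of type B (padded with zeros) such that λ_i = μ_i + 2 for 1 ≤ i ≤ m and λ_i = μ_i for i > m. Then there exists k ≥ 0 such that the set of parts of λ is exactly {1, 2, …, 2k+1}, the multiplicity of the largest part 2k+1 in λ is odd, and the multiplicity of every part j with 1 ≤ j ≤ 2k is even; i.e. λ = ((2k+1)^{2d_{2k+1}−1}, (2k)^{2d_{2k}}, …, 2^{2d_2}, 1^{2d_1}) for some positive integers d_1, …, d_{2k+1}. -/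
/-- A partition has positions `T v` such that the parts at least `v` are those before `T v`. -/
theorem PartitionOf.exists_cutoff {N : ℕ} (p : PartitionOf N) :
    ∃ T : ℕ → ℕ, ∀ v : ℕ, 1 ≤ v → ∀ j : ℕ, v ≤ p.parts j ↔ j < T v := by
  have key : ∀ v : ℕ, ∃ t : ℕ, 1 ≤ v → ∀ j : ℕ, v ≤ p.parts j ↔ j < t := by
    intro v
    by_cases hv : 1 ≤ v
    · have hex : ∃ j, p.parts j < v := by
        obtain ⟨j, hj⟩ := p.finite_support.exists_notMem
        refine ⟨j, ?_⟩
        rw [Function.notMem_support] at hj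
        omega
      refine ⟨Nat.find hex, fun _ j => ?_⟩
      rw [Nat.lt_find_iff]
      refine ⟨fun h i hi => not_lt.2 (h.trans (p.antitone i j hi)), fun h => not_lt.1 (h j le_rfl)⟩
    · exact ⟨0, fun h => absurd h hv⟩
  choose T hT using key
  exact ⟨T, hT⟩

/-- The parts of a partition eventually vanish. -/
theorem PartitionOf.exists_zero {N : ℕ} (p : PartitionOf N) :
    ∃ L : ℕ, ∀ j : ℕ, L ≤ j → p.parts j = 0 := by
  obtain ⟨T, hT⟩ := p.exists_cutoff
  refine ⟨T 1, fun j hj => ?_⟩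
  have := hT 1 le_rfl j
  omega

theorem finsum_eq_sum_range_s9 {f : ℕ → ℕ} {L : ℕ} (h : ∀ j : ℕ, L ≤ j → f j = 0) :
    ∑ᶠ i, f i = ∑ i ∈ Finset.range L, f i := by
  apply finsum_eq_sum_of_support_subset
  intro j hj
  by_contra hL
  exact hj (h j (by simpa using hL))

theorem partMult_eq_cutoff_sub {f T : ℕ → ℕ}
    (hT : ∀ v : ℕ, 1 ≤ v → ∀ j : ℕ, v ≤ f j ↔ j < T v) {v : ℕ} (hv : 1 ≤ v) :
    partMult f v = T v - T (v + 1) := by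
  have hset : {i : ℕ | f i = v} = Set.Ico (T (v + 1)) (T v) := by
    ext i
    have h1 := hT v hv i
    have h2 := hT (v + 1) (by omega) i
    simp only [Set.mem_ofPred_eq, Set.mem_Ico]
    omega
  rw [partMult, hset, Set.ncard_Ico_nat]

theorem transposeFn_eq_cutoff {f T : ℕ → ℕ}
    (hT : ∀ v : ℕ, 1 ≤ v → ∀ j : ℕ, v ≤ f j ↔ j < T v) (i : ℕ) :
    transposeFn f i = T (i + 1) := by
  have hset : {j : ℕ | i + 1 ≤ f j} = Set.Ico 0 (T (i + 1)) := by
    ext j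
    simp [← hT (i + 1) (by omega) j]
  rw [transposeFn, hset, Set.ncard_Ico_nat, Nat.sub_zero]

theorem partMult_transposeFn_s9 {f T : ℕ → ℕ}
    (hT : ∀ v : ℕ, 1 ≤ v → ∀ j : ℕ, v ≤ f j ↔ j < T v) (v : ℕ) :
    partMult (transposeFn f) (v + 1) = f v - f (v + 1) := by
  have hset : {i : ℕ | transposeFn f i = v + 1} = Set.Ico (f (v + 1)) (f v) := by
    ext i
    have h1 := hT (i + 1) (by omega) v
    have h2 := hT (i + 1) (by omega) (v + 1)
    simp only [Set.mem_ofPred_eq, Set.mem_Ico, transposeFn_eq_cutoff hT]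
    omega
  rw [partMult, hset, Set.ncard_Ico_nat]

theorem PartitionOf.finite_setOf_part_eq {N : ℕ} (p : PartitionOf N) {v : ℕ} (hv : 0 < v) :
    {i : ℕ | p.parts i = v}.Finite :=
  p.finite_support.subset fun i hi => by
    simp only [Set.mem_ofPred_eq] at hi
    simp only [Function.mem_support]
    omega

/-- Removing two columns of height `m` keeps a partition of type B when the `m`-th part exceeds
the next one by at least two. -/
theorem isTypeB_sub_two {N : ℕ} (p : PartitionOf N) (hB : IsTypeB p.parts) {m : ℕ}
    (hdrop : p.parts (m + 1) + 2 ≤ p.parts m) :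
    IsTypeB fun i => if i < m + 1 then p.parts i - 2 else p.parts i := by
  intro v hv hev
  set A : Set ℕ := {i | i < m + 1 ∧ p.parts i = v + 2}
  set B : Set ℕ := {i | m + 1 ≤ i ∧ p.parts i = v}
  have hset : {i : ℕ | (if i < m + 1 then p.parts i - 2 else p.parts i) = v} = A ∪ B := by
    ext i
    simp only [A, B, Set.mem_ofPred_eq, Set.mem_union]
    split_ifs <;> omega
  have hA : Even A.ncard := by
    by_cases h : p.parts (m + 1) < v + 2
    · have : A = {i | p.parts i = v + 2} := by
        ext i
        have := p.antitone (m + 1) i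
        simp only [A, Set.mem_ofPred_eq]
        omega
      rw [this]
      exact hB (v + 2) (by omega) (hev.add even_two)
    · have : A = ∅ := by
        refine Set.eq_empty_of_forall_notMem fun i hi => ?_
        obtain ⟨hi, hiv⟩ := hi
        have := p.antitone i m (by omega)
        omega
      simp [this]
  have hBcard : Even B.ncard := by
    by_cases h : v < p.parts m
    · have : B = {i | p.parts i = v} := by
        ext i
        have := p.antitone i m
        simp only [B, Set.mem_ofPred_eq]
        omega
      rw [this]
      exact hB v hv hev
    · have : B = ∅ := by
        refine Set.eq_empty_of_forall_notMem fun i hi => ?_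
        obtain ⟨hi, hiv⟩ := hi
        have := p.antitone (m + 1) i (by omega)
        omega
      simp [this]
  have hdisj : Disjoint A B := Set.disjoint_left.2 fun i hi hi' => by
    have h1 := hi.1
    have h2 := hi'.1
    omega
  rw [partMult, hset, Set.ncard_union_eq hdisj
    ((p.finite_setOf_part_eq (by omega : 0 < v + 2)).subset fun i hi => hi.2)
    ((p.finite_setOf_part_eq hv).subset fun i hi => hi.2)]
  exact hA.add hBcard

theorem sum_range_sub_two (f : ℕ → ℕ) (m d : ℕ) (h : ∀ i < m, 2 ≤ f i) :
    ∑ i ∈ Finset.range (m + d), f i =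
      ∑ i ∈ Finset.range (m + d), (if i < m then f i - 2 else f i) + 2 * m := by
  have hsplit : ∀ i ∈ Finset.range (m + d),
      f i = (if i < m then f i - 2 else f i) + if i < m then 2 else 0 := by
    intro i _
    have := h i
    split_ifs <;> omega
  rw [Finset.sum_congr rfl hsplit, Finset.sum_add_distrib]
  congr 1
  rw [Finset.sum_range_add]
  simp +contextual [Finset.sum_ite, Finset.filter_true_of_mem, mul_comm]

/-- If a part exceeds the next one by at least two, then the partition arises from a smaller
partition of type B by adding two columns. -/
theorem exists_typeB_of_drop {n : ℕ} (lam : PartitionOf (2 * n + 1)) (hB : IsTypeB lam.parts)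
    {m : ℕ} (hdrop : lam.parts (m + 1) + 2 ≤ lam.parts m) :
    m + 1 ≤ n ∧ ∃ mu : PartitionOf (2 * (n - (m + 1)) + 1), IsTypeB mu.parts ∧
      (∀ i : ℕ, i < m + 1 → lam.parts i = mu.parts i + 2) ∧
      (∀ i : ℕ, m + 1 ≤ i → lam.parts i = mu.parts i) := by
  obtain ⟨L, hL⟩ := lam.exists_zero
  have hge : ∀ i < m + 1, lam.parts (m + 1) + 2 ≤ lam.parts i := fun i hi =>
    hdrop.trans (lam.antitone i m (by omega))
  have hzero : ∀ j, m + 1 + L ≤ j → lam.parts j = 0 := fun j hj => hL j (by omega)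
  have hsum := lam.sum_eq
  rw [finsum_eq_sum_range_s9 hzero,
    sum_range_sub_two _ _ _ fun i hi => le_of_add_le_right (hge i hi)] at hsum
  refine ⟨by omega, ⟨fun i => if i < m + 1 then lam.parts i - 2 else lam.parts i, ?_, ?_, ?_⟩,
    isTypeB_sub_two lam hB hdrop, ?_, ?_⟩
  · intro i j hij
    have h1 := lam.antitone i j hij
    have h2 := hge i
    have h3 := lam.antitone (m + 1) j
    split_ifs <;> omega
  · refine lam.finite_support.subset fun i hi => ?_
    simp only [Function.mem_support] at hi ⊢
    split_ifs at hi <;> omega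
  · rw [finsum_eq_sum_range_s9 (L := m + 1 + L)]
    · omega
    · intro j hj
      rw [if_neg (by omega), hzero j hj]
  · intro i hi
    have := hge i hi
    simp only [hi, if_true]
    omega
  · intro i hi
    simp only [not_lt.2 hi, if_false]

theorem odd_sum_range_iff {f : ℕ → ℕ} (h : ∀ r : ℕ, Even (f (2 * r + 1) + f (2 * r + 2)))
    (L : ℕ) : Odd (∑ i ∈ Finset.range (2 * L + 1), f i) ↔ Odd (f 0) := by
  induction L with
  | zero => simp
  | succ L ih =>
    rw [show 2 * (L + 1) + 1 = 2 * L + 1 + 1 + 1 by ring, Finset.sum_range_succ,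
      Finset.sum_range_succ, add_assoc, Nat.odd_add, ih]
    simp [h L]

/-- a weakly rigid special partition in type B — i.e. a partition `λ` of
`2n+1` with `λ`, `λ^t` of type B which is not obtained by case (a) of Lusztig–Spaltenstein
induction from a type-B partition of `2(n−m)+1` for any `1 ≤ m ≤ n` — has parts exactly
`{1, …, 2k+1}`, with the top part `2k+1` of odd multiplicity and all smaller parts of even
multiplicity. -/
theorem weakly_rigid_typeB_shape
    {n : ℕ} (lam : PartitionOf (2 * n + 1))
    (hB : IsTypeB lam.parts)
    (htB : IsTypeB (transposeFn lam.parts))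
    (hrigid : ¬ ∃ m : ℕ, 1 ≤ m ∧ m ≤ n ∧
        ∃ mu : PartitionOf (2 * (n - m) + 1), IsTypeB mu.parts ∧
          (∀ i : ℕ, i < m → lam.parts i = mu.parts i + 2) ∧
          (∀ i : ℕ, m ≤ i → lam.parts i = mu.parts i)) :
    ∃ k : ℕ,
      (∀ i : ℕ, lam.parts i ≤ 2 * k + 1) ∧
      (∀ v : ℕ, 1 ≤ v → v ≤ 2 * k + 1 → ∃ i : ℕ, lam.parts i = v) ∧
      Odd (partMult lam.parts (2 * k + 1)) ∧
      (∀ j : ℕ, 1 ≤ j → j ≤ 2 * k → Even (partMult lam.parts j)) := by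
  obtain ⟨T, hT⟩ := lam.exists_cutoff
  have hstep : ∀ m, lam.parts m ≤ lam.parts (m + 1) + 1 := by
    intro m
    by_contra hm
    obtain ⟨hmn, hmu⟩ := exists_typeB_of_drop lam hB (m := m) (by omega)
    exact hrigid ⟨m + 1, by omega, hmn, hmu⟩
  have heq : ∀ r, lam.parts (2 * r + 1) = lam.parts (2 * r + 2) := by
    intro r
    have h1 := htB (2 * r + 1 + 1) (by omega) ⟨r + 1, by ring⟩
    rw [partMult_transposeFn_s9 hT] at h1
    have h2 := hstep (2 * r + 1)
    have h3 := lam.antitone (2 * r + 1) (2 * r + 2) (by omega)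
    rw [show 2 * r + 1 + 1 = 2 * r + 2 by ring] at h1 h2
    obtain ⟨c, hc⟩ := h1
    omega
  have hodd : Odd (lam.parts 0) := by
    obtain ⟨L, hL⟩ := lam.exists_zero
    rw [← odd_sum_range_iff (fun r => by rw [heq r]; exact Even.add_self _) L,
      ← finsum_eq_sum_range_s9 fun j hj => hL j (by omega), lam.sum_eq]
    exact odd_two_mul_add_one n
  obtain ⟨k, hk⟩ := hodd
  have hcut : ∀ v, 1 ≤ v → v ≤ 2 * k + 1 → Odd (T v) ∧ lam.parts (T v - 1) = v := by
    intro v hv hvk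
    have hpos := (hT v hv 0).1 (by omega)
    have h1 := hT v hv (T v - 1)
    have h2 := hT v hv (T v)
    have h3 := hstep (T v - 1)
    rw [Nat.sub_add_cancel hpos] at h3
    refine ⟨?_, by omega⟩
    by_contra hev
    obtain ⟨c, hc⟩ := Nat.not_odd_iff_even.1 hev
    have h4 := heq (c - 1)
    rw [show 2 * (c - 1) + 1 = T v - 1 by omega, show 2 * (c - 1) + 2 = T v by omega] at h4
    omega
  refine ⟨k, fun i => hk ▸ lam.antitone 0 i (Nat.zero_le i),
    fun v hv hvk => ⟨_, (hcut v hv hvk).2⟩, ?_, ?_⟩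
  · have htop := hT (2 * k + 1 + 1) (by omega) 0
    rw [partMult_eq_cutoff_sub hT (by omega), show T (2 * k + 1 + 1) = 0 by omega]
    exact (hcut _ (by omega) le_rfl).1
  · intro j hj hjk
    rw [partMult_eq_cutoff_sub hT hj]
    exact Nat.Odd.sub_odd (hcut j hj (by omega)).1 (hcut (j + 1) (by omega) (by omega)).1
end

section
/- Let n ≥ 0 and let λ be a partition of 2n such that both λ and λ^t are of type C. Assume there exist no m with 1 ≤ m ≤ n and no partition μ of 2(n−m) of type C (padded with zeros) such that λ_i = μ_i + 2 for 1 ≤ i ≤ m and λ_i = μ_i for i > m. Then there exists k ≥ 0 such that the set of parts of λ is exactly {1, 2, …, k} and every part of λ occurs with even (positive) multiplicity; i.e. λ = (k^{d_k}, (k−1)^{d_{k−1}}, …, 1^{d_1}) with all d_j positive even integers. -/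
namespace PartitionOf

variable {n : ℕ} (lam : PartitionOf n)

theorem finite_setOf_parts {p : ℕ → Prop} (hp : ¬ p 0) : {i | p (lam.parts i)}.Finite :=
  lam.finite_support.subset fun i hi h0 => hp (by simpa [h0] using hi)

/-- Subtracting `2` from the first `j + 1` entries of a sequence. -/
def subTwo (f : ℕ → ℕ) (j : ℕ) : ℕ → ℕ := fun i => if i ≤ j then f i - 2 else f i

theorem subTwo_antitone {j : ℕ} (hj : lam.parts (j + 1) + 2 ≤ lam.parts j) (a b : ℕ)
    (hab : a ≤ b) : subTwo lam.parts j b ≤ subTwo lam.parts j a := by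
  have h := lam.antitone a b hab
  unfold subTwo
  split_ifs with hb ha ha
  · omega
  · omega
  · have h1 := lam.antitone a j ha
    have h2 := lam.antitone (j + 1) b (by omega)
    omega
  · exact h

theorem subTwo_finite_support (j : ℕ) : (Function.support (subTwo lam.parts j)).Finite := by
  refine lam.finite_support.subset fun i hi h0 => hi ?_
  simp [subTwo, h0]

theorem finsum_subTwo {j : ℕ} (hj : lam.parts (j + 1) + 2 ≤ lam.parts j) :
    ∑ᶠ i, subTwo lam.parts j i + 2 * (j + 1) = n := by
  have hs : (Function.support fun i => if i ≤ j then 2 else 0).Finite :=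
    (Set.finite_Iic j).subset fun i hi => by
      by_contra h
      exact hi (if_neg h)
  have h2 : ∑ᶠ i, (if i ≤ j then 2 else 0) = 2 * (j + 1) := by
    rw [finsum_eq_sum_of_support_subset (s := Finset.range (j + 1))]
    · rw [Finset.sum_congr rfl fun i hi => if_pos (by simp at hi; omega)]
      simp [mul_comm]
    · intro i hi
      by_contra h
      exact hi (if_neg (by simpa using h))
  rw [← h2, ← finsum_add_distrib (lam.subTwo_finite_support j) hs]
  refine Eq.trans (finsum_congr fun i => ?_) lam.sum_eq
  unfold subTwo
  split_ifs with h
  · have := lam.antitone i j h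
    omega
  · simp

theorem isTypeC_subTwo (hC : IsTypeC lam.parts) {j : ℕ}
    (hj : lam.parts (j + 1) + 2 ≤ lam.parts j) : IsTypeC (subTwo lam.parts j) := by
  intro v hv hodd
  have hle : ∀ i, i ≤ j → lam.parts j ≤ lam.parts i := fun i => lam.antitone i j
  have hgt : ∀ i, j < i → lam.parts i ≤ lam.parts (j + 1) := fun i => lam.antitone (j + 1) i
  have hsplit : {i | subTwo lam.parts j i = v} =
      {i | i ≤ j ∧ lam.parts i = v + 2} ∪ {i | j < i ∧ lam.parts i = v} := by
    ext i
    have := hle i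
    simp only [subTwo, Set.mem_union, Set.mem_ofPred_eq]
    split_ifs <;> omega
  have hfin : ∀ w, 0 < w → {i | lam.parts i = w}.Finite := fun w hw =>
    lam.finite_setOf_parts (p := (· = w)) hw.ne
  have hupper : Even {i | i ≤ j ∧ lam.parts i = v + 2}.ncard := by
    by_cases h : lam.parts j ≤ v + 2
    · convert hC (v + 2) (by omega) (by grind) using 1
      refine congrArg Set.ncard (Set.ext fun i => ?_)
      have := hgt i
      simp only [Set.mem_ofPred_eq]
      omega
    · rw [Set.eq_empty_of_forall_notMem (s := {i | i ≤ j ∧ lam.parts i = v + 2}) fun i hi => by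
        have := hle i hi.1
        have := hi.2
        omega]
      simp
  have hlower : Even {i | j < i ∧ lam.parts i = v}.ncard := by
    by_cases h : v ≤ lam.parts (j + 1)
    · convert hC v hv hodd using 1
      refine congrArg Set.ncard (Set.ext fun i => ?_)
      have := hle i
      simp only [Set.mem_ofPred_eq]
      omega
    · rw [Set.eq_empty_of_forall_notMem (s := {i | j < i ∧ lam.parts i = v}) fun i hi => by
        have := hgt i hi.1
        have := hi.2
        omega]
      simp
  rw [partMult, hsplit, Set.ncard_union_eq
    (Set.disjoint_left.2 fun i hi hi' => by have := hi.1; have := hi'.1; omega)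
    ((hfin (v + 2) (by omega)).subset fun i hi => hi.2) ((hfin v hv).subset fun i hi => hi.2)]
  exact hupper.add hlower

/-- A partition whose consecutive entries differ by at most one takes every value
between `1` and its largest part. -/
theorem exists_parts_eq (hgap : ∀ j, lam.parts j ≤ lam.parts (j + 1) + 1) {v : ℕ}
    (hv : 1 ≤ v) (hv0 : v ≤ lam.parts 0) : ∃ i, lam.parts i = v := by
  have hex : ∃ i, lam.parts i < v := by
    obtain ⟨i, hi⟩ := lam.finite_support.exists_notMem
    exact ⟨i, by rw [Function.notMem_support.1 hi]; omega⟩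
  classical
  obtain ⟨j, hj⟩ := Nat.exists_eq_succ_of_ne_zero (n := Nat.find hex) fun h => by
    have := Nat.find_spec hex
    rw [h] at this
    omega
  have h1 : lam.parts (j + 1) < v := by
    simpa only [hj] using Nat.find_spec hex
  have h2 : ¬ lam.parts j < v := Nat.find_min hex (by omega)
  have h3 := hgap j
  exact ⟨j, by omega⟩

theorem transposeFn_lt {v w i : ℕ} (hvw : v < w) (hi : lam.parts i = v + 1) :
    transposeFn lam.parts w < transposeFn lam.parts v := by
  refine Set.ncard_lt_ncard ⟨fun a ha => ?_, fun h => ?_⟩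
    (lam.finite_setOf_parts (p := (v + 1 ≤ ·)) (by omega))
  · simp only [Set.mem_ofPred_eq] at ha ⊢
    omega
  · have : w + 1 ≤ lam.parts i := h (show v + 1 ≤ lam.parts i from hi.ge)
    omega

theorem transposeFn_eq_partMult_add (v : ℕ) :
    transposeFn lam.parts v = partMult lam.parts (v + 1) + transposeFn lam.parts (v + 1) := by
  unfold transposeFn partMult
  rw [← Set.ncard_union_eq
    (Set.disjoint_left.2 fun i hi hi' => by simp only [Set.mem_ofPred_eq] at hi hi'; omega)
    (lam.finite_setOf_parts (p := (· = v + 1)) (by omega))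
    (lam.finite_setOf_parts (p := (v + 1 + 1 ≤ ·)) (by omega))]
  refine congrArg Set.ncard (Set.ext fun i => ?_)
  simp only [Set.mem_ofPred_eq, Set.mem_union]
  omega

/-- If every value up to the largest part occurs, the columns have distinct lengths, so a
transpose of type C forces them all to be even. -/
theorem even_transposeFn (htC : IsTypeC (transposeFn lam.parts))
    (hval : ∀ v, 1 ≤ v → v ≤ lam.parts 0 → ∃ i, lam.parts i = v) (v : ℕ) :
    Even (transposeFn lam.parts v) := by
  by_contra hne
  have hodd := Nat.not_even_iff_odd.1 hne
  have hv : v < lam.parts 0 := by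
    obtain ⟨i, hi⟩ := Set.nonempty_of_ncard_ne_zero hodd.pos.ne'
    have := lam.antitone 0 i (Nat.zero_le i)
    simp only [Set.mem_ofPred_eq] at hi
    omega
  have hsingle : {i | transposeFn lam.parts i = transposeFn lam.parts v} = {v} := by
    ext i
    simp only [Set.mem_ofPred_eq, Set.mem_singleton_iff]
    refine ⟨fun h => ?_, fun h => h ▸ rfl⟩
    rcases lt_trichotomy i v with hiv | hiv | hiv
    · obtain ⟨a, ha⟩ := hval (i + 1) (by omega) (by omega)
      exact absurd h (lam.transposeFn_lt hiv ha).ne'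
    · exact hiv
    · obtain ⟨a, ha⟩ := hval (v + 1) (by omega) (by omega)
      exact absurd h (lam.transposeFn_lt hiv ha).ne
  have := htC _ hodd.pos hodd
  rw [partMult, hsingle, Set.ncard_singleton] at this
  exact absurd this (by decide)

end PartitionOf

/-- a weakly rigid special partition in type C — i.e. a partition `λ` of
`2n` with `λ`, `λ^t` of type C which is not obtained by case (a) of Lusztig–Spaltenstein
induction from a type-C partition of `2(n−m)` for any `1 ≤ m ≤ n` — has parts exactly
`{1, …, k}`, every part occurring with even (positive) multiplicity. -/
theorem weakly_rigid_typeC_shape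
    {n : ℕ} (lam : PartitionOf (2 * n))
    (hC : IsTypeC lam.parts)
    (htC : IsTypeC (transposeFn lam.parts))
    (hrigid : ¬ ∃ m : ℕ, 1 ≤ m ∧ m ≤ n ∧
        ∃ mu : PartitionOf (2 * (n - m)), IsTypeC mu.parts ∧
          (∀ i : ℕ, i < m → lam.parts i = mu.parts i + 2) ∧
          (∀ i : ℕ, m ≤ i → lam.parts i = mu.parts i)) :
    ∃ k : ℕ,
      (∀ i : ℕ, lam.parts i ≤ k) ∧
      (∀ v : ℕ, 1 ≤ v → v ≤ k → ∃ i : ℕ, lam.parts i = v) ∧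
      (∀ v : ℕ, 1 ≤ v → v ≤ k → Even (partMult lam.parts v)) := by
  have hgap : ∀ j, lam.parts j ≤ lam.parts (j + 1) + 1 := by
    intro j
    by_contra hlt
    have hj : lam.parts (j + 1) + 2 ≤ lam.parts j := by omega
    have hsum := lam.finsum_subTwo hj
    refine hrigid ⟨j + 1, by omega, by omega,
      ⟨PartitionOf.subTwo lam.parts j, lam.subTwo_antitone hj, lam.subTwo_finite_support j,
        by omega⟩, lam.isTypeC_subTwo hC hj, fun i hi => ?_, fun i hi => ?_⟩
    · have := lam.antitone i j (by omega)
      simp only [PartitionOf.subTwo, if_pos (show i ≤ j by omega)]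
      omega
    · simp only [PartitionOf.subTwo, if_neg (show ¬ i ≤ j by omega)]
  have hval : ∀ v, 1 ≤ v → v ≤ lam.parts 0 → ∃ i, lam.parts i = v :=
    fun v => lam.exists_parts_eq hgap
  refine ⟨lam.parts 0, fun i => lam.antitone 0 i (Nat.zero_le i), hval, fun v hv _ => ?_⟩
  obtain ⟨w, rfl⟩ := Nat.exists_eq_add_of_le' hv
  have h := lam.even_transposeFn htC hval w
  rw [lam.transposeFn_eq_partMult_add, Nat.even_add] at h
  exact h.2 (lam.even_transposeFn htC hval (w + 1))
end

section
/- Let n ≥ 0 and let λ be a partition of 2n such that λ is of type D and λ^t is of type C. Assume there exist no m with 1 ≤ m ≤ n and no partition μ of 2(n−m) of type D (padded with zeros) such that λ_i = μ_i + 2 for 1 ≤ i ≤ m and λ_i = μ_i for i > m. Then there exists k ≥ 0 such that the set of parts of λ is exactly {1, 2, …, k} and every part of λ occurs with even (positive) multiplicity; i.e. λ = (k^{d_k}, (k−1)^{d_{k−1}}, …, 1^{d_1}) with all d_j positive even integers. -/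
theorem PartitionOf.finite_le {n : ℕ} (p : PartitionOf n) {v : ℕ} (hv : 0 < v) :
    {j : ℕ | v ≤ p.parts j}.Finite :=
  p.finite_support.subset fun j (hj : v ≤ p.parts j) => (by
    simp only [Function.mem_support]; omega)

theorem PartitionOf.exists_parts_eq_zero {n : ℕ} (p : PartitionOf n) : ∃ i, p.parts i = 0 := by
  obtain ⟨i, hi⟩ := p.finite_support.exists_notMem
  exact ⟨i, by simpa using hi⟩

theorem PartitionOf.partMult_add_transposeFn {n : ℕ} (p : PartitionOf n) (v : ℕ) :
    partMult p.parts (v + 1) + transposeFn p.parts (v + 1) = transposeFn p.parts v := by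
  have hfin : {j | p.parts j = v + 1}.Finite :=
    (p.finite_le (Nat.succ_pos v)).subset fun j (hj : p.parts j = v + 1) => hj.ge
  unfold partMult transposeFn
  rw [← Set.ncard_union_eq ?_ hfin (p.finite_le (v + 1).succ_pos)]
  · congr 1
    ext j
    simp only [Set.mem_union, Set.mem_ofPred_eq]
    omega
  · exact Set.disjoint_left.2 fun j hj hj' => by
      simp only [Set.mem_ofPred_eq] at hj hj'
      omega

theorem PartitionOf.transposeFn_lt_of_parts_eq {n : ℕ} (p : PartitionOf n) {v w i : ℕ}
    (hvw : v < w) (hi : p.parts i = v + 1) :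
    transposeFn p.parts w < transposeFn p.parts v := by
  refine Set.ncard_lt_ncard ⟨fun j (hj : w + 1 ≤ p.parts j) => ?_, fun h => ?_⟩
    (p.finite_le (Nat.succ_pos v))
  · show v + 1 ≤ p.parts j
    omega
  · have : w + 1 ≤ p.parts i := h (show v + 1 ≤ p.parts i from hi.ge)
    omega

/-- If consecutive parts differ by at most one, every value up to the largest part occurs. -/
theorem PartitionOf.exists_parts_eq_of_le {n : ℕ} (p : PartitionOf n)
    (hgap : ∀ i, p.parts i ≤ p.parts (i + 1) + 1) {v : ℕ} (hv : 0 < v) (hv0 : v ≤ p.parts 0) :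
    ∃ i, p.parts i = v := by
  have hex : ∃ i, p.parts i < v := by
    obtain ⟨i, hi⟩ := p.exists_parts_eq_zero
    exact ⟨i, by omega⟩
  obtain ⟨i, hi, hmin⟩ : ∃ i, p.parts i < v ∧ ∀ j < i, ¬ p.parts j < v :=
    ⟨Nat.find hex, Nat.find_spec hex, fun j => Nat.find_min hex⟩
  rcases i with _ | i
  · omega
  · have := hmin i (Nat.lt_succ_self i)
    have := hgap i
    exact ⟨i, by omega⟩

/-- Removing two boxes from each of the first `m` rows. -/
def removeTwo (f : ℕ → ℕ) (m : ℕ) : ℕ → ℕ := fun j => if j < m then f j - 2 else f j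

theorem PartitionOf.finsum_removeTwo {n : ℕ} (p : PartitionOf n) {m : ℕ}
    (h2 : ∀ j < m, 2 ≤ p.parts j) :
    ∑ᶠ j, removeTwo p.parts m j + 2 * m = n := by
  have hsum : ∑ᶠ j, (if j < m then 2 else 0) = 2 * m := by
    rw [finsum_eq_sum_of_support_subset (s := Finset.range m)]
    · rw [Finset.sum_congr rfl fun j hj => if_pos (Finset.mem_range.1 hj)]
      simp [mul_comm]
    · intro j
      simp
  rw [← hsum, ← finsum_add_distrib]
  · refine (finsum_congr fun j => ?_).trans p.sum_eq
    unfold removeTwo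
    split_ifs with h
    · exact Nat.sub_add_cancel (h2 j h)
    · rfl
  · refine p.finite_support.subset fun j hj => ?_
    simp only [Function.mem_support, removeTwo] at hj ⊢
    split_ifs at hj <;> omega
  · refine (Set.finite_lt_nat m).subset fun j hj => ?_
    simpa using hj

theorem PartitionOf.isTypeD_removeTwo {n : ℕ} (p : PartitionOf n) (hD : IsTypeD p.parts) {i : ℕ}
    (hgap : p.parts (i + 1) + 2 ≤ p.parts i) : IsTypeD (removeTwo p.parts (i + 1)) := by
  intro v hv hev
  have hle : ∀ j < i + 1, p.parts i ≤ p.parts j := fun j hj => p.antitone _ _ (by omega)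
  have hge : ∀ j, ¬ j < i + 1 → p.parts j ≤ p.parts (i + 1) :=
    fun j hj => p.antitone _ _ (by omega)
  have hsplit : {j | removeTwo p.parts (i + 1) j = v} =
      {j | j < i + 1 ∧ p.parts j = v + 2} ∪ {j | ¬ j < i + 1 ∧ p.parts j = v} := by
    ext j
    simp only [removeTwo, Set.mem_ofPred_eq, Set.mem_union]
    have := hle j
    split_ifs <;> omega
  unfold partMult
  rw [hsplit, Set.ncard_union_eq (Set.disjoint_left.2 fun j hj hj' => hj'.1 hj.1)
    ((Set.finite_lt_nat (i + 1)).subset fun j hj => hj.1)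
    ((p.finite_le hv).subset fun j hj => hj.2.ge)]
  refine Even.add ?_ ?_
  · by_cases h : p.parts i ≤ v + 2
    · have hset : {j | j < i + 1 ∧ p.parts j = v + 2} = {j | p.parts j = v + 2} := by
        ext j
        have := hge j
        simp only [Set.mem_ofPred_eq]
        omega
      rw [hset]
      exact hD (v + 2) (by omega) (hev.add even_two)
    · have hset : {j | j < i + 1 ∧ p.parts j = v + 2} = ∅ := by
        ext j
        have := hle j
        simp only [Set.mem_ofPred_eq, Set.mem_empty_iff_false, iff_false]
        omega
      rw [hset, Set.ncard_empty]
      exact Even.zero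
  · by_cases h : v ≤ p.parts (i + 1)
    · have hset : {j | ¬ j < i + 1 ∧ p.parts j = v} = {j | p.parts j = v} := by
        ext j
        have := hle j
        simp only [Set.mem_ofPred_eq]
        omega
      rw [hset]
      exact hD v hv hev
    · have hset : {j | ¬ j < i + 1 ∧ p.parts j = v} = ∅ := by
        ext j
        have := hge j
        simp only [Set.mem_ofPred_eq, Set.mem_empty_iff_false, iff_false]
        omega
      rw [hset, Set.ncard_empty]
      exact Even.zero

/-- a weakly rigid special partition in type D — i.e. a partition `λ` of
`2n` of type D with `λ^t` of type C which is not obtained by case (a) of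
Lusztig–Spaltenstein induction from a type-D partition of `2(n−m)` for any `1 ≤ m ≤ n` —
has parts exactly `{1, …, k}`, every part occurring with even (positive) multiplicity. -/
theorem weakly_rigid_typeD_shape
    {n : ℕ} (lam : PartitionOf (2 * n))
    (hD : IsTypeD lam.parts)
    (htC : IsTypeC (transposeFn lam.parts))
    (hrigid : ¬ ∃ m : ℕ, 1 ≤ m ∧ m ≤ n ∧
        ∃ mu : PartitionOf (2 * (n - m)), IsTypeD mu.parts ∧
          (∀ i : ℕ, i < m → lam.parts i = mu.parts i + 2) ∧
          (∀ i : ℕ, m ≤ i → lam.parts i = mu.parts i)) :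
    ∃ k : ℕ,
      (∀ i : ℕ, lam.parts i ≤ k) ∧
      (∀ v : ℕ, 1 ≤ v → v ≤ k → ∃ i : ℕ, lam.parts i = v) ∧
      (∀ v : ℕ, 1 ≤ v → v ≤ k → Even (partMult lam.parts v)) := by
  have hgap : ∀ i, lam.parts i ≤ lam.parts (i + 1) + 1 := by
    intro i
    by_contra! h
    have hle : ∀ j < i + 1, lam.parts i ≤ lam.parts j := fun j hj => lam.antitone _ _ (by omega)
    have hsum := lam.finsum_removeTwo (m := i + 1) fun j hj => by have := hle j hj; omega
    refine hrigid ⟨i + 1, by omega, by omega,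
      ⟨removeTwo lam.parts (i + 1), fun j k hjk => ?_, ?_, by omega⟩,
      lam.isTypeD_removeTwo hD h, fun j hj => ?_, fun j hj => ?_⟩
    · have := lam.antitone j k hjk
      have := hle j
      have := lam.antitone (i + 1) k
      simp only [removeTwo]
      split_ifs <;> omega
    · refine lam.finite_support.subset fun j hj => ?_
      simp only [Function.mem_support, removeTwo] at hj ⊢
      split_ifs at hj <;> omega
    · have := hle j hj
      simp only [removeTwo, if_pos hj]
      omega
    · simp only [removeTwo, if_neg (not_lt.2 hj)]
  have hpart : ∀ v, 1 ≤ v → v ≤ lam.parts 0 → ∃ i, lam.parts i = v :=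
    fun v hv hv0 => lam.exists_parts_eq_of_le hgap hv hv0
  have heven : ∀ v, Even (transposeFn lam.parts v) := by
    intro v
    by_contra hodd
    rw [Nat.not_even_iff_odd] at hodd
    obtain ⟨j, hj⟩ : {j : ℕ | v + 1 ≤ lam.parts j}.Nonempty :=
      Set.nonempty_of_ncard_ne_zero hodd.pos.ne'
    have hv0 : v + 1 ≤ lam.parts 0 := le_trans hj (lam.antitone 0 j (Nat.zero_le j))
    have hone : {w | transposeFn lam.parts w = transposeFn lam.parts v} = {v} := by
      ext w
      simp only [Set.mem_ofPred_eq, Set.mem_singleton_iff]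
      refine ⟨fun hw => ?_, fun hw => hw ▸ rfl⟩
      rcases lt_trichotomy w v with h | h | h
      · obtain ⟨i, hi⟩ := hpart (w + 1) (by omega) (by omega)
        exact absurd hw (lam.transposeFn_lt_of_parts_eq h hi).ne'
      · exact h
      · obtain ⟨i, hi⟩ := hpart (v + 1) (by omega) hv0
        exact absurd hw (lam.transposeFn_lt_of_parts_eq h hi).ne
    have := htC _ hodd.pos hodd
    rw [partMult, hone, Set.ncard_singleton] at this
    exact Nat.not_even_one this
  refine ⟨lam.parts 0, fun i => lam.antitone 0 i (Nat.zero_le i), hpart, fun v hv _ => ?_⟩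
  obtain ⟨w, rfl⟩ := Nat.exists_eq_add_of_le' hv
  have h := heven w
  rw [← lam.partMult_add_transposeFn w, Nat.even_add] at h
  exact h.2 (heven (w + 1))
end

section
/- Let λ be a partition of 2n+1 whose set of parts is exactly {1, 2, …, 2k+1} for some k ≥ 0, with the largest part 2k+1 occurring with odd multiplicity and every part j ≤ 2k occurring with even multiplicity. Let ν = l(λ^t) be the partition of 2n obtained from λ^t by decreasing its smallest nonzero part by 1. Then there exists a partition ρ of 2n such that: ρ is of type C; ρ is dominated by ν; every partition of 2n of type C that is dominated by ν is dominated by ρ (so ρ is the C-collapse [ν]_C of ν); and every nonzero part of ρ is even. -/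
/-- If `f` is non-increasing of type C and drops strictly after its first `j + 1` entries, then
those entries form complete multiplicity classes, so their sum is even. -/
theorem IsTypeC.even_sum_range {f : ℕ → ℕ} (hC : IsTypeC f)
    (hf : ∀ i j : ℕ, i ≤ j → f j ≤ f i) {j : ℕ} (hj : f (j + 1) < f j) :
    Even (∑ i ∈ Finset.range (j + 1), f i) := by
  classical
  rw [← Finset.sum_fiberwise_of_maps_to (s := Finset.range (j + 1))
    (t := (Finset.range (j + 1)).image f) (g := f)
    (fun i hi => Finset.mem_image_of_mem f hi)]
  refine Finset.even_sum _ fun v hv => ?_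
  obtain ⟨a, ha, rfl⟩ := Finset.mem_image.1 hv
  rw [Finset.mem_range] at ha
  have hsum : ∑ i ∈ Finset.range (j + 1) with f i = f a, f i =
      ((Finset.range (j + 1)).filter fun i => f i = f a).card * f a := by
    rw [Finset.sum_congr rfl fun i hi => (Finset.mem_filter.1 hi).2, Finset.sum_const,
      smul_eq_mul]
  have haj := hf a j (by omega)
  have hmult : partMult f (f a) =
      ((Finset.range (j + 1)).filter fun i => f i = f a).card := by
    rw [partMult, ← Set.ncard_coe_finset]
    congr 1
    ext i
    simp only [Finset.coe_filter, Finset.mem_range, Set.mem_ofPred_eq]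
    refine ⟨fun h => ⟨?_, h⟩, fun h => h.2⟩
    by_contra hij
    have := hf (j + 1) i (by omega)
    omega
  rw [hsum, ← hmult]
  rcases Nat.even_or_odd (f a) with h | h
  · exact h.mul_left _
  · exact (hC _ h.pos h).mul_right _

theorem finite_setOf_succ_le {f : ℕ → ℕ} (hf : (Function.support f).Finite) (i : ℕ) :
    {j : ℕ | i + 1 ≤ f j}.Finite :=
  hf.subset fun j hj => by
    simp only [Set.mem_ofPred_eq] at hj
    simp only [Function.mem_support]
    omega

theorem transposeFn_eq_partMult_add {f : ℕ → ℕ} (hf : (Function.support f).Finite) (i : ℕ) :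
    transposeFn f i = partMult f (i + 1) + transposeFn f (i + 1) := by
  unfold transposeFn partMult
  rw [← Set.ncard_union_eq _ _ (finite_setOf_succ_le hf (i + 1))]
  · congr 1
    ext j
    simp only [Set.mem_ofPred_eq, Set.mem_union]
    omega
  · rw [Set.disjoint_left]
    intro j hj hj'
    simp only [Set.mem_ofPred_eq] at hj hj'
    omega
  · exact (finite_setOf_succ_le hf i).subset fun j hj => (Set.mem_ofPred_eq ▸ hj).ge

theorem transposeFn_eq_zero {f : ℕ → ℕ} {i : ℕ} (hf : ∀ j, f j ≤ i) : transposeFn f i = 0 := by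
  have h : {j : ℕ | i + 1 ≤ f j} = ∅ := by
    ext j
    have := hf j
    simp only [Set.mem_ofPred_eq, Set.mem_empty_iff_false, iff_false]
    omega
  rw [transposeFn, h, Set.ncard_empty]

theorem partMult_pos {f : ℕ → ℕ} (hf : (Function.support f).Finite) {v : ℕ} (hv : 1 ≤ v)
    (h : ∃ i, f i = v) : 0 < partMult f v := by
  obtain ⟨i, hi⟩ := h
  refine (Set.ncard_pos (hf.subset fun j hj => ?_)).2 ⟨i, hi⟩
  simp only [Set.mem_ofPred_eq] at hj
  simp only [Function.mem_support]
  omega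

/-- Transposition preserves the sum of the parts. -/
theorem sum_transposeFn {f : ℕ → ℕ} (hf : (Function.support f).Finite) {m : ℕ}
    (hm : ∀ j, f j ≤ m) : ∑ i ∈ Finset.range m, transposeFn f i = ∑ᶠ j, f j := by
  classical
  have ht : ∀ i, transposeFn f i = ∑ j ∈ hf.toFinset, if i < f j then 1 else 0 := by
    intro i
    rw [← Finset.card_filter, transposeFn, ← Set.ncard_coe_finset]
    congr 1
    ext j
    simp only [Finset.coe_filter, Set.Finite.mem_toFinset, Function.mem_support,
      Set.mem_ofPred_eq]
    omega
  rw [finsum_eq_sum_of_support_toFinset_subset f hf subset_rfl,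
    Finset.sum_congr rfl fun i _ => ht i, Finset.sum_comm]
  refine Finset.sum_congr rfl fun j _ => ?_
  rw [← Finset.card_filter]
  have h : (Finset.range m).filter (fun i => i < f j) = Finset.range (f j) := by
    ext i
    have := hm j
    simp only [Finset.mem_filter, Finset.mem_range]
    omega
  rw [h, Finset.card_range]

/-- Given `2k+1` parts `t 0, …, t (2k)`, lower the even-indexed ones and raise the odd-indexed
ones by `1`. -/
def evenShift (k : ℕ) (t : ℕ → ℕ) (i : ℕ) : ℕ :=
  if 2 * k < i then 0 else if i % 2 = 0 then t i - 1 else t i + 1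

theorem even_evenShift {k : ℕ} {t : ℕ → ℕ} (hodd : ∀ i ≤ 2 * k, Odd (t i)) (i : ℕ) :
    Even (evenShift k t i) := by
  unfold evenShift
  split_ifs with h₁ h₂
  · exact Even.zero
  · exact (hodd i (by omega)).tsub_odd odd_one
  · exact (hodd i (by omega)).add_odd odd_one

theorem evenShift_antitone {k : ℕ} {t : ℕ → ℕ} (hodd : ∀ i ≤ 2 * k, Odd (t i))
    (hlt : ∀ i < 2 * k, t (i + 1) < t i) : Antitone (evenShift k t) := by
  refine antitone_nat_of_succ_le fun i => ?_
  unfold evenShift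
  by_cases hi : i < 2 * k
  · have h₁ := Nat.odd_iff.1 (hodd i (by omega))
    have h₂ := Nat.odd_iff.1 (hodd (i + 1) (by omega))
    have h₃ := hlt i hi
    split_ifs <;> omega
  · rw [if_pos (by omega)]
    exact Nat.zero_le _

/-- The partial sums of `evenShift k t` and of `t` with its last part lowered by `1` differ
exactly at the odd positions up to `2k`, where they differ by `1`. -/
theorem sum_range_evenShift {k : ℕ} {t : ℕ → ℕ} (hodd : ∀ i ≤ 2 * k, Odd (t i))
    (hzero : ∀ i, 2 * k < i → t i = 0) (j : ℕ) :
    ∑ i ∈ Finset.range j, evenShift k t i + (if j % 2 = 1 ∧ j ≤ 2 * k then 1 else 0) =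
      ∑ i ∈ Finset.range j, Function.update t (2 * k) (t (2 * k) - 1) i := by
  induction j with
  | zero => simp
  | succ j ih =>
    rw [Finset.sum_range_succ, Finset.sum_range_succ, ← ih]
    unfold evenShift
    rcases lt_trichotomy j (2 * k) with h | rfl | h
    · have h₁ := (hodd j h.le).pos
      rw [Function.update_of_ne h.ne]
      split_ifs <;> omega
    · rw [Function.update_self]
      split_ifs <;> omega
    · rw [Function.update_of_ne h.ne', hzero j h]
      split_ifs <;> omega

/-- Any type C partition dominated by `t` with its last part lowered by `1` is dominated by
`evenShift k t`. -/
theorem IsTypeC.dominated_evenShift {k : ℕ} {t f : ℕ → ℕ} (hodd : ∀ i ≤ 2 * k, Odd (t i))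
    (hlt : ∀ i < 2 * k, t (i + 1) < t i) (hzero : ∀ i, 2 * k < i → t i = 0)
    (hC : IsTypeC f) (hf : ∀ i j : ℕ, i ≤ j → f j ≤ f i)
    (hdom : Dominated f (Function.update t (2 * k) (t (2 * k) - 1))) :
    Dominated f (evenShift k t) := by
  intro j
  have hj := hdom j
  have hsum := sum_range_evenShift hodd hzero j
  split_ifs at hsum with hcase
  swap
  · omega
  by_contra hcon
  obtain ⟨m, rfl⟩ : ∃ m, j = m + 1 := ⟨j - 1, by omega⟩
  have heq : ∑ i ∈ Finset.range (m + 1), f i =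
      ∑ i ∈ Finset.range (m + 1), evenShift k t i + 1 := by omega
  have hprev := hdom m
  have hnext := hdom (m + 2)
  rw [Finset.sum_range_succ _ (m + 1), Finset.sum_range_succ _ (m + 1),
    Function.update_of_ne (by omega)] at hnext
  have hsplit := Finset.sum_range_succ f m
  have hsplit' := Finset.sum_range_succ (Function.update t (2 * k) (t (2 * k) - 1)) m
  rw [Function.update_of_ne (by omega : m ≠ 2 * k)] at hsplit'
  have hdrop := hlt m (by omega)
  have h₁ := hC.even_sum_range hf (j := m) (by omega)
  have h₂ := Finset.even_sum (s := Finset.range (m + 1)) (evenShift k t)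
    fun i _ => even_evenShift hodd i
  rw [heq] at h₁
  exact Nat.not_even_iff_odd.2 h₂.add_one h₁

/-- let `λ` be a partition of `2n+1` whose parts are exactly `{1,…,2k+1}`,
the top part `2k+1` with odd multiplicity and all smaller parts with even multiplicity
(the shape of a weakly rigid special orbit in `so_{2n+1}`). Let `ν = l(λ^t)` be obtained
from `λ^t` by decreasing its smallest nonzero part (the last nonzero entry, at index `i0`)
by `1`. Then the C-collapse `[ν]_C` exists as a partition `ρ` of `2n` — type C, dominated
by `ν`, and dominance-largest among type-C partitions of `2n` dominated by `ν` — and all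
nonzero parts of `ρ` are even. -/
theorem collapse_C_of_dual_weakly_rigid_typeB_is_even
    {n k : ℕ} (lam : PartitionOf (2 * n + 1))
    (hbound : ∀ i : ℕ, lam.parts i ≤ 2 * k + 1)
    (hall : ∀ v : ℕ, 1 ≤ v → v ≤ 2 * k + 1 → ∃ i : ℕ, lam.parts i = v)
    (htop : Odd (partMult lam.parts (2 * k + 1)))
    (heven : ∀ j : ℕ, 1 ≤ j → j ≤ 2 * k → Even (partMult lam.parts j))
    (i0 : ℕ)
    (hi0 : transposeFn lam.parts i0 ≠ 0)
    (hi0' : ∀ j : ℕ, i0 < j → transposeFn lam.parts j = 0)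
    (nu : ℕ → ℕ)
    (hnu : nu = Function.update (transposeFn lam.parts) i0 (transposeFn lam.parts i0 - 1)) :
    ∃ rho : PartitionOf (2 * n),
      IsTypeC rho.parts ∧
      Dominated rho.parts nu ∧
      (∀ sigma : PartitionOf (2 * n),
        IsTypeC sigma.parts → Dominated sigma.parts nu → Dominated sigma.parts rho.parts) ∧
      (∀ i : ℕ, rho.parts i ≠ 0 → Even (rho.parts i)) := by
  have hfin := lam.finite_support
  set t := transposeFn lam.parts with ht
  have hzero : ∀ i, 2 * k < i → t i = 0 := fun i hi =>
    transposeFn_eq_zero fun j => (hbound j).trans (by omega)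
  have hstep : ∀ i, t i = partMult lam.parts (i + 1) + t (i + 1) :=
    transposeFn_eq_partMult_add hfin
  have hodd : ∀ i ≤ 2 * k, Odd (t i) := by
    intro i hi
    induction hi using Nat.decreasingInduction with
    | self => rw [hstep, hzero (2 * k + 1) (by omega)]; exact htop
    | of_succ i hi ih => rw [hstep]; exact (heven (i + 1) (by omega) (by omega)).add_odd ih
  have hlt : ∀ i < 2 * k, t (i + 1) < t i := by
    intro i hi
    have h₁ := partMult_pos hfin (by omega) (hall (i + 1) (by omega) (by omega))
    have h₂ := hstep i
    omega
  obtain rfl : i0 = 2 * k := by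
    rcases lt_trichotomy i0 (2 * k) with h | h | h
    · exact absurd (hi0' _ h) (hodd _ le_rfl).pos.ne'
    · exact h
    · exact absurd (hzero _ h) hi0
  have hsupp : Function.support (evenShift k t) ⊆ Finset.range (2 * k + 1) := by
    intro i hi
    by_contra h
    simp only [Finset.coe_range, Set.mem_Iio] at h
    exact hi (if_pos (by omega))
  have hsum : ∑ᶠ i, evenShift k t i = 2 * n := by
    have h₁ := sum_range_evenShift hodd hzero (2 * k + 1)
    have h₂ := sum_transposeFn hfin hbound
    have h₃ := (hodd _ le_rfl).pos
    have h₄ : ∑ i ∈ Finset.range (2 * k), Function.update t (2 * k) (t (2 * k) - 1) i =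
        ∑ i ∈ Finset.range (2 * k), t i :=
      Finset.sum_congr rfl fun i hi => Function.update_of_ne (Finset.mem_range.1 hi).ne _ t
    rw [lam.sum_eq, ← ht, Finset.sum_range_succ] at h₂
    rw [if_neg (by omega), Finset.sum_range_succ (Function.update _ _ _), Function.update_self,
      h₄] at h₁
    rw [finsum_eq_sum_of_support_subset _ hsupp]
    omega
  have heven' := even_evenShift hodd
  refine ⟨⟨evenShift k t, fun i j hij => evenShift_antitone hodd hlt hij,
    (Finset.finite_toSet _).subset hsupp, hsum⟩, ?_, ?_, ?_, fun i _ => heven' i⟩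
  · intro v _ hv
    have h : {i : ℕ | evenShift k t i = v} = ∅ := by
      ext i
      simp only [Set.mem_ofPred_eq, Set.mem_empty_iff_false, iff_false]
      rintro rfl
      exact Nat.not_even_iff_odd.2 hv (heven' i)
    rw [partMult, h, Set.ncard_empty]
    exact Even.zero
  · intro j
    rw [hnu, ← sum_range_evenShift hodd hzero j]
    exact Nat.le_add_right _ _
  · intro sigma hC hdom
    rw [hnu] at hdom
    exact hC.dominated_evenShift hodd hlt hzero sigma.antitone hdom
end
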